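/- Let Γ = (γ_{ij})_{i,j=1}^N be a matrix of functions, each γ_{ij} of class K∞ or identically zero, and let μ_1,…,μ_N be MAFs on [0,∞)^N. Define Γ_μ : [0,∞)^N → [0,∞)^N by Γ_μ(r)_i = μ_i(γ_{i1}(r_1),…,γ_{iN}(r_N)). Suppose Γ is irreducible, i.e. the directed graph on vertices {1,…,N} with an edge from j to i whenever γ_{ij} ≢ 0 is strongly connected, and suppose Γ_μ ≱ id, i.e. for every r ∈ [0,∞)^N with r ≠ 0 there exists i with μ_i(γ_{i1}(r_1),…,γ_{iN}(r_N)) < r_i. Then there exists an Ω-path with respect to Γ_μ: functions σ_1,…,σ_N of class K∞ such that (i) each inverse σ_i⁻¹ is locally Lipschitz continuous on (0,∞); (ii) for every compact set K ⊂ (0,∞) there exist constants 0 < c < C such that for every i and every r ∈ K at which σ_i⁻¹ is differentiable, c ≤ (σ_i⁻¹)'(r) ≤ C; and (iii) Γ_μ(σ(r)) < σ(r) componentwise for all r > 0, where σ(r) = (σ_1(r),…,σ_N(r)). -/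

import Mathlib

/-- A function `f : [0,∞) → [0,∞)` is of class K if it is continuous, strictly
increasing and `f 0 = 0`. -/
def ClassK (f : ℝ → ℝ) : Prop :=
  ContinuousOn f (Set.Ici 0) ∧ StrictMonoOn f (Set.Ici 0) ∧
    (∀ r, 0 ≤ r → 0 ≤ f r) ∧ f 0 = 0

/-- A function is of class K∞ if it is of class K and unbounded. -/
def ClassKInf (f : ℝ → ℝ) : Prop :=
  ClassK f ∧ Filter.Tendsto f Filter.atTop Filter.atTop

/-- A monotone aggregation function on `[0,∞)^m`: continuous, nonnegative, positive on
nonzero nonnegative vectors, strictly increasing componentwise, and unbounded. -/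
def MAF {m : ℕ} (μ : (Fin m → ℝ) → ℝ) : Prop :=
  Continuous μ ∧
    (∀ v : Fin m → ℝ, (∀ k, 0 ≤ v k) → 0 ≤ μ v) ∧
    (∀ v : Fin m → ℝ, (∀ k, 0 ≤ v k) → v ≠ 0 → 0 < μ v) ∧
    (∀ v z : Fin m → ℝ, (∀ k, z k < v k) → μ z < μ v) ∧
    (∀ M : ℝ, ∃ R : ℝ, ∀ v : Fin m → ℝ, (∀ k, 0 ≤ v k) → R ≤ ‖v‖ → M ≤ μ v)

open Filter Topology

/-- The greatest solution of `x = r ⊔ F x` for an irreducible monotone map `F` satisfying the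
small-gain condition above `r`. -/
theorem exists_eq_sup_map {α ι : Type*} [ConditionallyCompleteLinearOrder α] [NoMaxOrder α]
    [Fintype ι] [Nonempty ι] {E : ι → ι → Prop} (hE : ∀ i j, Relation.TransGen E i j)
    {F : (ι → α) → ι → α} (hmono : Monotone F)
    (hgrow : ∀ j i, E j i → ∀ M, ∃ R, ∀ x, R ≤ x j → M ≤ F x i)
    (r : ι → α) (hr : ∀ x, r ≤ x → ∃ i, F x i < x i) : ∃ x, x = r ⊔ F x := by
  set S : Set (ι → α) := {x | r ≤ x ∧ x ≤ r ⊔ F x} with hS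
  have step : ∀ x ∈ S, r ⊔ F x ∈ S ∧ x ≤ r ⊔ F x := fun x hx =>
    ⟨⟨le_sup_left, sup_le_sup_left (hmono hx.2) r⟩, hx.2⟩
  have reach : ∀ j i, Relation.TransGen E j i →
      ∀ M, ∃ R, ∀ x ∈ S, R ≤ x j → ∃ y ∈ S, x ≤ y ∧ M ≤ y i := by
    intro j i h
    induction h with
    | single h =>
      intro M
      obtain ⟨R, hR⟩ := hgrow _ _ h M
      exact ⟨R, fun x hx hxj => ⟨_, (step x hx).1, (step x hx).2, (hR x hxj).trans le_sup_right⟩⟩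
    | tail _ h ih =>
      intro M
      obtain ⟨R, hR⟩ := hgrow _ _ h M
      obtain ⟨R', hR'⟩ := ih R
      refine ⟨R', fun x hx hxj => ?_⟩
      obtain ⟨y, hy, hxy, hyR⟩ := hR' x hx hxj
      exact ⟨_, (step y hy).1, hxy.trans (step y hy).2, (hR y hyR).trans le_sup_right⟩
  choose M hM using fun i => exists_gt (r i)
  choose R hR using fun j i => reach j i (hE j i) (M i)
  have hbdd : BddAbove S := by
    refine ⟨fun j => Finset.univ.sup' Finset.univ_nonempty (R j), fun x hx j => ?_⟩
    by_contra! hlt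
    choose y hy _ hyM using fun i => hR j i x hx
      ((Finset.le_sup' (R j) (Finset.mem_univ i)).trans hlt.le)
    set z := Finset.univ.sup' Finset.univ_nonempty y with hz
    have hyz : ∀ i, y i ≤ z := fun i => Finset.le_sup' y (Finset.mem_univ i)
    have hzF : z ≤ r ⊔ F z := Finset.sup'_le _ _ fun i _ =>
      (hy i).2.trans (sup_le_sup_left (hmono (hyz i)) r)
    have hrz : r ≤ z := (hy j).1.trans (hyz j)
    obtain ⟨i, hi⟩ := hr z hrz
    rcases le_sup_iff.1 (hzF i) with h | h
    · exact absurd ((hM i).trans_le ((hyM i).trans (hyz i i))) h.not_gt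
    · exact h.not_gt hi
  have hle : sSup S ≤ r ⊔ F (sSup S) := csSup_le ⟨r, le_rfl, le_sup_left⟩ fun x hx =>
    hx.2.trans (sup_le_sup_left (hmono (le_csSup hbdd hx)) r)
  have hmem : sSup S ∈ S := ⟨le_csSup hbdd ⟨le_rfl, le_sup_left⟩, hle⟩
  exact ⟨sSup S, hle.antisymm (le_csSup hbdd (step _ hmem).1)⟩

/-- The small-gain condition improves to a uniform one: some index `i` has
`F r i ≤ r i - δ (r i)`, with `δ` a positive `1`-Lipschitz function of the coordinate alone. -/
theorem exists_gap_function {ι : Type*} [Fintype ι] [Nonempty ι] {E : ι → ι → Prop}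
    (hE : ∀ i j, Relation.TransGen E i j)
    {F : (ι → ℝ) → ι → ℝ} (hcont : Continuous F) (hmono : Monotone F) (hnonneg : ∀ x, 0 ≤ F x)
    (hgrow : ∀ j i, E j i → ∀ M, ∃ R, ∀ x, R ≤ x j → M ≤ F x i)
    (hsg : ∀ x, 0 ≤ x → x ≠ 0 → ∃ i, F x i < x i) :
    ∃ δ : ℝ → ℝ, (∀ s, 0 < s → 0 < δ s ∧ δ s ≤ s) ∧ (∀ s t, δ s ≤ δ t + |s - t|) ∧
      ∀ r, 0 ≤ r → r ≠ 0 → ∃ i, F r i ≤ r i - δ (r i) := by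
  have hF0 : F 0 = 0 := by
    by_contra h
    obtain ⟨i, hi⟩ := hsg (F 0) (hnonneg 0) h
    exact (hmono (hnonneg 0) i).not_gt hi
  have hbound : ∀ i j, ∀ b, ∃ B, ∀ x, F x ≤ x → x i ≤ b → x j ≤ B := by
    intro i j
    induction hE j i with
    | single h =>
      intro b
      obtain ⟨R, hR⟩ := hgrow _ _ h (b + 1)
      refine ⟨R, fun x hx hxb => ?_⟩
      by_contra! hlt
      linarith [(hR x hlt.le).trans (hx _)]
    | tail _ h ih =>
      intro b
      obtain ⟨R, hR⟩ := hgrow _ _ h (b + 1)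
      obtain ⟨B, hB⟩ := ih R
      refine ⟨B, fun x hx hxb => hB x hx ?_⟩
      by_contra! hlt
      linarith [(hR x hlt.le).trans (hx _)]
  let Ω : Set (ι → ℝ) := {x | 0 ≤ x ∧ F x ≤ x}
  let φ : ℝ → Ω × ι → ℝ := fun s p => ‖p.1.1 - F p.1.1‖ + |p.1.1 p.2 - s|
  have h0 : (0 : ι → ℝ) ∈ Ω := ⟨le_rfl, hF0.le⟩
  have : Nonempty (Ω × ι) := ⟨⟨⟨0, h0⟩, Classical.arbitrary ι⟩⟩
  have hbdd : ∀ s, BddBelow (Set.range (φ s)) := fun s =>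
    ⟨0, by rintro _ ⟨p, rfl⟩; positivity⟩
  refine ⟨fun s => ⨅ p, φ s p, fun s hs => ⟨?_, ?_⟩, fun s t => ?_, fun r hr hr0 => ?_⟩
  · choose B hB using fun i j => hbound i j (2 * s)
    have hK : IsCompact (Set.Icc (0 : ι → ℝ)
        (fun j => Finset.univ.sup' Finset.univ_nonempty fun i => B i j) ∩ {x | s / 2 ≤ ‖x‖}) :=
      isCompact_Icc.inter_right (isClosed_le continuous_const continuous_norm)
    obtain ⟨ε, hε, hε'⟩ := hK.exists_forall_le' (f := fun x => ‖x - F x‖) (a := 0)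
      (by fun_prop) (by
        rintro x ⟨hx, hxs⟩
        rw [norm_pos_iff, sub_ne_zero]
        intro h
        obtain ⟨i, hi⟩ := hsg x hx.1 (by rintro rfl; simp at hxs; linarith)
        exact (congrFun h i).not_gt hi)
    refine (lt_min hε (half_pos hs)).trans_le (le_ciInf fun p => ?_)
    obtain ⟨⟨x, hx0, hxF⟩, i⟩ := p
    change _ ≤ ‖x - F x‖ + |x i - s|
    by_cases h : |x i - s| < s / 2
    · rw [abs_lt] at h
      refine (min_le_left _ _).trans ((hε' x ⟨⟨hx0, fun j => ?_⟩, ?_⟩).trans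
        (le_add_of_nonneg_right (abs_nonneg _)))
      · exact (hB i j x hxF (by linarith)).trans
          (Finset.le_sup' (fun i => B i j) (Finset.mem_univ i))
      · exact le_trans (by linarith) ((le_abs_self _).trans (norm_le_pi_norm x i))
    · exact (min_le_right _ _).trans ((not_lt.1 h).trans (le_add_of_nonneg_left (norm_nonneg _)))
  · refine (ciInf_le (hbdd s) ⟨⟨0, h0⟩, Classical.arbitrary ι⟩).trans ?_
    simp [φ, hF0, abs_of_pos hs]
  · change (⨅ p, φ s p) ≤ (⨅ p, φ t p) + |s - t|
    rw [← sub_le_iff_le_add]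
    refine le_ciInf fun p => ?_
    rw [sub_le_iff_le_add]
    refine (ciInf_le (hbdd s) p).trans ?_
    have := abs_sub_le (p.1.1 p.2) t s
    rw [abs_sub_comm t s] at this
    simp only [φ]
    linarith
  · obtain ⟨x, hx⟩ := exists_eq_sup_map hE hmono hgrow r fun x hx => hsg x (hr.trans hx) (by
      rintro rfl; exact hr0 (le_antisymm hx hr))
    have hrx : r ≤ x := hx ▸ le_sup_left
    have hFx : F x ≤ x := by conv_rhs => rw [hx]
                             exact le_sup_right
    have hx0 : 0 ≤ x := hr.trans hrx
    obtain ⟨i, hi⟩ := Finite.exists_max fun i => x i - F x i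
    have hnorm : ‖x - F x‖ ≤ x i - F x i := by
      refine (pi_norm_le_iff_of_nonneg (sub_nonneg.2 (hFx i))).2 fun j => ?_
      rw [Pi.sub_apply, Real.norm_of_nonneg (sub_nonneg.2 (hFx j))]
      exact hi j
    obtain ⟨k, hk⟩ := hsg x hx0 (by rintro rfl; exact hr0 (le_antisymm hrx hr))
    have hlt : F x i < x i := by linarith [hi k]
    have hri : x i = r i := by
      have h := congrFun hx i
      rcases le_total (r i) (F x i) with h' | h'
      · rw [Pi.sup_apply, sup_of_le_right h'] at h; linarith
      · rwa [Pi.sup_apply, sup_of_le_left h'] at h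
    refine ⟨i, ?_⟩
    have h1 : (⨅ p, φ (r i) p) ≤ ‖x - F x‖ := by
      refine (ciInf_le (hbdd _) ⟨⟨x, hx0, hFx⟩, i⟩).trans ?_
      simp [φ, hri]
    have h2 := hmono hrx i
    simp only
    linarith

/-- A grid of `(0,∞)` indexed by the integers, two steps of which are shorter than `δ`. -/
theorem exists_grid {δ : ℝ → ℝ} (hδ : ∀ s, 0 < s → 0 < δ s ∧ δ s ≤ s)
    (hlip : ∀ s t, δ s ≤ δ t + |s - t|) :
    ∃ g : ℤ → ℝ, StrictMono g ∧ (∀ k, 0 < g k) ∧ (∀ ε > 0, ∃ k, g k < ε) ∧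
      (∀ M, ∃ k, M < g k) ∧ ∀ k, g k - δ (g k) < g (k - 2) := by
  have hcont : Continuous δ := by
    refine LipschitzWith.continuous (K := 1) (LipschitzWith.of_le_add fun s t => ?_)
    rw [Real.dist_eq]; exact hlip s t
  let u : ℕ → ℝ := fun n => (fun s => s + δ s / 4)^[n] 1
  let d : ℕ → ℝ := fun n => (fun s => s - δ s / 4)^[n] 1
  have hu : ∀ n, u (n + 1) = u n + δ (u n) / 4 := fun n => Function.iterate_succ_apply' _ _ _
  have hd : ∀ n, d (n + 1) = d n - δ (d n) / 4 := fun n => Function.iterate_succ_apply' _ _ _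
  have hupos : ∀ n, 1 ≤ u n := by
    intro n
    induction n with
    | zero => exact le_rfl
    | succ n ih => rw [hu]; linarith [(hδ (u n) (by linarith)).1]
  have hdpos : ∀ n, 0 < d n := by
    intro n
    induction n with
    | zero => exact one_pos
    | succ n ih => rw [hd]; linarith [(hδ (d n) ih).2]
  let g : ℤ → ℝ := fun k => match k with
    | Int.ofNat n => u n
    | Int.negSucc n => d (n + 1)
  have hgpos : ∀ k, 0 < g k := by
    rintro (n | n)
    · exact one_pos.trans_le (hupos n)
    · exact hdpos _
  have hstep : ∀ k, g (k + 1) = g k + δ (g k) / 4 ∨ g k = g (k + 1) - δ (g (k + 1)) / 4 := by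
    rintro (n | n)
    · exact Or.inl (hu n)
    · rcases n with _ | n
      · exact Or.inr (hd 0)
      · exact Or.inr (hd (n + 1))
  have hlt : ∀ k, g k < g (k + 1) := by
    intro k
    rcases hstep k with h | h
    · rw [h]; linarith [(hδ _ (hgpos k)).1]
    · rw [h]; linarith [(hδ _ (hgpos (k + 1))).1]
  have hmono : StrictMono g := strictMono_int_of_lt_succ hlt
  have hgap : ∀ k, g k - g (k - 1) ≤ δ (g k) / 3 := by
    intro k
    have h1 := hstep (k - 1)
    have h2 := hlt (k - 1)
    rw [sub_add_cancel] at h1 h2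
    have h3 := hlip (g (k - 1)) (g k)
    rw [abs_sub_comm, abs_of_pos (sub_pos.2 h2)] at h3
    have h4 := (hδ _ (hgpos k)).1
    rcases h1 with h | h <;> linarith
  refine ⟨g, hmono, hgpos, ?_, ?_, fun k => ?_⟩
  · intro ε hε
    have hanti : Antitone d := antitone_nat_of_succ_le fun n => by
      rw [hd]; linarith [(hδ _ (hdpos n)).1]
    have hlim := tendsto_atTop_ciInf hanti ⟨0, by rintro _ ⟨n, rfl⟩; exact (hdpos n).le⟩
    set l := ⨅ n, d n
    have hl0 : 0 ≤ l := ge_of_tendsto' hlim fun n => (hdpos n).le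
    have heq : l = l - δ l / 4 := by
      refine tendsto_nhds_unique ((tendsto_add_atTop_iff_nat 1).2 hlim) ?_
      simp only [hd]
      exact hlim.sub (((hcont.tendsto l).comp hlim).div_const 4)
    have hl : l = 0 := by
      by_contra h
      linarith [(hδ l (lt_of_le_of_ne hl0 (Ne.symm h))).1]
    rw [hl] at hlim
    obtain ⟨n, hn⟩ := ((tendsto_add_atTop_iff_nat 1).2 hlim |>.eventually_lt_const hε).exists
    exact ⟨Int.negSucc n, hn⟩
  · intro M
    by_contra! hM
    have humono : Monotone u := monotone_nat_of_le_succ fun n => by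
      rw [hu]; linarith [(hδ _ (one_pos.trans_le (hupos n))).1]
    have hlim := tendsto_atTop_ciSup humono ⟨M, by rintro _ ⟨n, rfl⟩; exact hM (Int.ofNat n)⟩
    set l := ⨆ n, u n
    have hl0 : 1 ≤ l := ge_of_tendsto' hlim hupos
    have heq : l = l + δ l / 4 := by
      refine tendsto_nhds_unique ((tendsto_add_atTop_iff_nat 1).2 hlim) ?_
      simp only [hu]
      exact hlim.add (((hcont.tendsto l).comp hlim).div_const 4)
    linarith [(hδ l (by linarith)).1]
  · have h1 := hgap k
    have h2 := hgap (k - 1)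
    rw [sub_sub, one_add_one_eq_two] at h2
    have h3 := hlip (g (k - 1)) (g k)
    rw [abs_sub_comm, abs_of_pos (sub_pos.2 (hmono (sub_one_lt k)))] at h3
    linarith [(hδ _ (hgpos k)).1]

/-- Pigeonhole principle for a decreasing family of predicates on a finite set. -/
theorem exists_mem_forall_of_antitone {β : Type*} {s : Set β} (hs : s.Finite) {P : ℤ → β → Prop}
    (hP : ∀ M M', M ≤ M' → ∀ b, P M' b → P M b) (M₀ : ℤ) (h : ∀ M, M₀ ≤ M → ∃ b ∈ s, P M b) :
    ∃ b ∈ s, ∀ M, P M b := by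
  by_contra! hcon
  choose! M hM using hcon
  obtain ⟨C, hC⟩ := (hs.image M).bddAbove
  obtain ⟨b, hb, hPb⟩ := h (max M₀ C) (le_max_left _ _)
  exact hM b hb (hP _ _ ((hC ⟨b, hb, rfl⟩).trans (le_max_right _ _)) b hPb)

/-- An irreducible monotone map of `ℤ^ι` satisfying the small-gain condition has a monotone
bi-infinite backward orbit that is unbounded in both directions in every coordinate. -/
theorem exists_biinfinite_orbit {ι : Type*} [Fintype ι] [Nonempty ι] {E : ι → ι → Prop}
    (hE : ∀ i j, Relation.TransGen E i j)
    {F : (ι → ℤ) → ι → ℤ} (hmono : Monotone F) (hsg : ∀ x, ∃ i, F x i < x i)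
    (hgrow : ∀ j i, E j i → ∀ M, ∃ R, ∀ x, R ≤ x j → M ≤ F x i)
    (hlow : ∀ j i, E j i → ∀ R, ∃ M, ∀ x, R ≤ x j → M ≤ F x i) :
    ∃ x : ℤ → ι → ℤ, Monotone x ∧ (∀ k, F (x (k + 1)) = x k) ∧
      (∀ M, ∃ k, ∀ i, M ≤ x k i) ∧ ∀ M, ∃ k, ∀ i, x k i ≤ M := by
  have hup : ∀ j i, ∀ M, ∃ R, ∀ x, F x ≤ x → R ≤ x j → M ≤ F x i := by
    intro j i
    induction hE j i with
    | single h =>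
      intro M
      obtain ⟨R, hR⟩ := hgrow _ _ h M
      exact ⟨R, fun x _ => hR x⟩
    | tail _ h ih =>
      intro M
      obtain ⟨R, hR⟩ := hgrow _ _ h M
      obtain ⟨R', hR'⟩ := ih R
      exact ⟨R', fun x hx hxj => hR x ((hR' x hx hxj).trans (hx _))⟩
  have hdown : ∀ j i, ∀ R, ∃ M, ∀ x, F x ≤ x → R ≤ x j → M ≤ F x i := by
    intro j i R
    induction hE j i with
    | single h =>
      obtain ⟨M, hM⟩ := hlow _ _ h R
      exact ⟨M, fun x _ => hM x⟩
    | tail _ h ih =>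
      obtain ⟨R', hR'⟩ := ih
      obtain ⟨M, hM⟩ := hlow _ _ h R'
      exact ⟨M, fun x hx hxj => hM x ((hR' x hx hxj).trans (hx _))⟩
  have hup' : ∀ M, ∃ R, ∀ x, F x ≤ x → ∀ j, R ≤ x j → ∀ i, M ≤ F x i := by
    intro M
    choose R hR using fun j i => hup j i M
    refine ⟨Finset.univ.sup' Finset.univ_nonempty fun p : ι × ι => R p.1 p.2,
      fun x hx j hj i => hR j i x hx (le_trans ?_ hj)⟩
    exact Finset.le_sup' (fun p : ι × ι => R p.1 p.2) (Finset.mem_univ (j, i))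
  have hdown' : ∀ R, ∃ M, ∀ x, F x ≤ x → ∀ j, R ≤ x j → ∀ i, M ≤ F x i := by
    intro R
    choose M hM using fun j i => hdown j i R
    refine ⟨Finset.univ.inf' Finset.univ_nonempty fun p : ι × ι => M p.1 p.2,
      fun x hx j hj i => le_trans ?_ (hM j i x hx hj)⟩
    exact Finset.inf'_le (fun p : ι × ι => M p.1 p.2) (Finset.mem_univ (j, i))
  have hsum : ∀ x, F x ≤ x → ∑ i, F x i + 1 ≤ ∑ i, x i := by
    intro x hx
    obtain ⟨i, hi⟩ := hsg x
    exact Finset.sum_lt_sum (fun j _ => hx j) ⟨i, Finset.mem_univ i, hi⟩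
  have hiter : ∀ x, F x ≤ x → ∀ L, F (F^[L] x) ≤ F^[L] x := by
    intro x hx L
    rw [← Function.iterate_succ_apply' F L x, Function.iterate_succ_apply F L x]
    exact hmono.iterate L hx
  have hsmall : ∀ M, ∃ C, ∀ x, F x ≤ x → ∑ i, x i ≤ C → ∀ i, x i ≤ M := by
    intro M
    obtain ⟨R, hR⟩ := hdown' (M + 1)
    refine ⟨∑ _i : ι, (R - 1), fun x hx hxs i => ?_⟩
    by_contra! hlt
    refine hxs.not_gt (Finset.sum_lt_sum_of_nonempty Finset.univ_nonempty fun j _ => ?_)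
    have := (hR x hx i hlt j).trans (hx j)
    lia
  have hlarge : ∀ M, ∃ C, ∀ x, F x ≤ x → C ≤ ∑ i, x i → ∀ i, M ≤ x i := by
    intro M
    obtain ⟨R, hR⟩ := hup' M
    refine ⟨∑ _i : ι, R, fun x hx hxs i => ?_⟩
    obtain ⟨j, -, hj⟩ := Finset.exists_le_of_sum_le Finset.univ_nonempty hxs
    exact (hR x hx j hj i).trans (hx i)
  have hsumL : ∀ x, F x ≤ x → ∀ L : ℕ, ∑ i, F^[L] x i + L ≤ ∑ i, x i := by
    intro x hx L
    induction L with
    | zero => simp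
    | succ L ih =>
      have := hsum _ (hiter x hx L)
      rw [Function.iterate_succ_apply']
      push_cast
      lia
  let P : ℤ → (ι → ℤ) → Prop := fun M x => ∃ w, (∀ i, M ≤ w i) ∧ F w ≤ w ∧ ∃ L, F^[L] w = x
  have hPanti : ∀ M M', M ≤ M' → ∀ x, P M' x → P M x :=
    fun M M' h x ⟨w, hw, hw'⟩ => ⟨w, fun i => h.trans (hw i), hw'⟩
  have hPdecay : ∀ M x, P M x → F x ≤ x := by
    rintro M x ⟨w, -, hw, L, rfl⟩
    exact hiter w hw L
  have hfin : ∀ a b : ι → ℤ, (Set.Icc a b).Finite := by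
    classical exact fun a b => Set.finite_Icc a b
  have hstart : ∃ x, ∀ M, P M x := by
    let i₀ : ι := Classical.arbitrary ι
    obtain ⟨M₁, hM₁⟩ := hdown' 1
    obtain ⟨R₁, hR₁⟩ := hup' 1
    obtain ⟨C, hC⟩ := hsmall 0
    obtain ⟨x, -, hx⟩ := exists_mem_forall_of_antitone (hfin (fun _ => M₁) fun _ => R₁) hPanti 1
      (by
        intro M hM
        obtain ⟨w, hw⟩ := exists_eq_sup_map hE hmono hgrow (fun _ => M) fun x _ => hsg x
        have hMw : ∀ i, M ≤ w i := fun i => by rw [hw]; exact le_sup_left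
        have hFw : F w ≤ w := by
          conv_rhs => rw [hw]
          exact le_sup_right
        have hex : ∃ L, F^[L] w i₀ ≤ 0 := by
          refine ⟨(∑ i, w i - C).toNat, hC _ (hiter w hFw _) ?_ i₀⟩
          have h1 := hsumL w hFw (∑ i, w i - C).toNat
          have h2 := Int.self_le_toNat (∑ i, w i - C)
          lia
        classical
        obtain ⟨L, hL, hmin⟩ : ∃ L, F^[L] w i₀ ≤ 0 ∧ ∀ L' < L, ¬ F^[L'] w i₀ ≤ 0 :=
          ⟨Nat.find hex, Nat.find_spec hex, fun _ => Nat.find_min hex⟩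
        refine ⟨F^[L] w, ⟨fun i => ?_, fun i => ?_⟩, w, hMw, hFw, L, rfl⟩
        · rcases L with _ | L
          · exact absurd hL (not_le.2 (by have := hMw i₀; simp only [Function.iterate_zero, id]; lia))
          · rw [Function.iterate_succ_apply']
            exact hM₁ _ (hiter w hFw L) i₀ (not_le.1 (hmin L L.lt_succ_self)) i
        · by_contra! hlt
          have h1 := hR₁ _ (hiter w hFw L) i hlt.le i₀
          have h2 := hiter w hFw L i₀
          lia)
    exact ⟨x, hx⟩
  have hprev : ∀ x : {x // ∀ M, P M x}, ∃ y : {x // ∀ M, P M x}, F y.1 = x.1 := by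
    rintro ⟨x, hx⟩
    choose R hR using fun j => hup' (x j + 1)
    let i₀ : ι := Classical.arbitrary ι
    have hfib : {y | F y ≤ y ∧ F y = x}.Finite := by
      refine (hfin x fun _ => R i₀).subset ?_
      rintro y ⟨hy, hyx⟩
      refine ⟨hyx ▸ hy, fun j => ?_⟩
      by_contra! hlt
      have h1 := hR i₀ y hy j hlt.le i₀
      rw [hyx] at h1
      lia
    obtain ⟨y, hy, hyP⟩ := exists_mem_forall_of_antitone hfib hPanti (x i₀ + 1) (by
      intro M hM
      obtain ⟨w, hMw, hFw, L, hL⟩ := hx M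
      rcases L with _ | L
      · have h1 := hMw i₀
        rw [Function.iterate_zero, id] at hL
        rw [hL] at h1
        lia
      · rw [Function.iterate_succ_apply'] at hL
        exact ⟨F^[L] w, ⟨hiter w hFw L, hL⟩, w, hMw, hFw, L, rfl⟩)
    exact ⟨⟨y, hyP⟩, hy.2⟩
  choose prev hprev using hprev
  obtain ⟨x₀, hx₀⟩ := hstart
  let u : ℕ → {x // ∀ M, P M x} := fun n => prev^[n] ⟨x₀, hx₀⟩
  have hu : ∀ n, F (u (n + 1)).1 = (u n).1 := fun n => by
    simp only [u]
    rw [Function.iterate_succ_apply', hprev]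
  let x : ℤ → ι → ℤ := fun k => match k with
    | Int.ofNat n => (u n).1
    | Int.negSucc n => F^[n + 1] x₀
  have hx : ∀ k, F (x (k + 1)) = x k := by
    rintro (n | n)
    · exact hu n
    · rcases n with _ | n
      · rfl
      · exact (Function.iterate_succ_apply' F (n + 1) x₀).symm
  have hxF : ∀ k, F (x k) ≤ x k := by
    rintro (n | n)
    · exact hPdecay 0 _ ((u n).2 0)
    · exact hiter x₀ (hPdecay 0 _ (hx₀ 0)) _
  have hxsum : Monotone fun k => ∑ i, x k i - k := monotone_int_of_le_succ fun k => by
    have := hsum _ (hxF (k + 1))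
    rw [hx] at this
    lia
  refine ⟨x, monotone_int_of_le_succ fun k => ?_, hx, fun M => ?_, fun M => ?_⟩
  · have := hxF (k + 1)
    rwa [hx] at this
  · obtain ⟨C, hC⟩ := hlarge M
    refine ⟨max 0 (C - ∑ i, x 0 i), hC _ (hxF _) ?_⟩
    have := hxsum (le_max_left 0 (C - ∑ i, x 0 i))
    simp only at this
    lia
  · obtain ⟨C, hC⟩ := hsmall M
    refine ⟨min 0 (C - ∑ i, x 0 i), hC _ (hxF _) ?_⟩
    have := hxsum (min_le_left 0 (C - ∑ i, x 0 i))
    simp only at this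
    lia

/-- The piecewise linear interpolation of a sequence indexed by the integers. -/
noncomputable def intInterp (p : ℤ → ℝ) (x : ℝ) : ℝ :=
  p ⌊x⌋ + Int.fract x * (p (⌊x⌋ + 1) - p ⌊x⌋)

theorem mul_le_intInterp_sub {p : ℤ → ℝ} {c : ℝ} {a b : ℤ}
    (h : ∀ k, a ≤ k → k ≤ b → c ≤ p (k + 1) - p k) {x y : ℝ} (hax : a ≤ x) (hxy : x ≤ y)
    (hyb : y ≤ b) : c * (y - x) ≤ intInterp p y - intInterp p x := by
  have tele : ∀ m n : ℤ, a ≤ m → m ≤ n → n ≤ b → c * (n - m) ≤ p n - p m := by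
    intro m n ham hmn
    induction n, hmn using Int.leInduction with
    | base => intro _; simp
    | succ n hmn ih =>
      intro hn
      have h1 := ih (by lia)
      have h2 := h n (by lia) (by lia)
      push_cast
      linarith
  have hax' : a ≤ ⌊x⌋ := Int.le_floor.2 hax
  have hyb' : ⌊y⌋ ≤ b := by exact_mod_cast (Int.floor_le y).trans hyb
  have hfl : ⌊x⌋ ≤ ⌊y⌋ := Int.floor_mono hxy
  have hx := Int.floor_add_fract x
  have hy := Int.floor_add_fract y
  have hx0 := Int.fract_nonneg x
  have hx1 := Int.fract_lt_one x
  have hy0 := Int.fract_nonneg y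
  have hdx := h ⌊x⌋ hax' (hfl.trans hyb')
  have hdy := h ⌊y⌋ (hax'.trans hfl) hyb'
  unfold intInterp
  rcases hfl.eq_or_lt with heq | hlt
  · rw [← heq] at hy ⊢
    have : 0 ≤ (Int.fract y - Int.fract x) * (p (⌊x⌋ + 1) - p ⌊x⌋ - c) :=
      mul_nonneg (by linarith) (by linarith)
    have h3 : y - x = Int.fract y - Int.fract x := by linarith
    rw [h3]
    linarith
  · have h1 := tele (⌊x⌋ + 1) ⌊y⌋ (by lia) (by lia) hyb'
    have h2 : 0 ≤ Int.fract y * (p (⌊y⌋ + 1) - p ⌊y⌋ - c) := mul_nonneg hy0 (by linarith)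
    have h3 : 0 ≤ (1 - Int.fract x) * (p (⌊x⌋ + 1) - p ⌊x⌋ - c) :=
      mul_nonneg (by linarith) (by linarith)
    have h4 : y - x = (⌊y⌋ - (⌊x⌋ + 1)) + Int.fract y + (1 - Int.fract x) := by linarith
    push_cast at h1
    rw [h4]
    linarith

theorem intInterp_sub_le_mul {p : ℤ → ℝ} {C : ℝ} {a b : ℤ}
    (h : ∀ k, a ≤ k → k ≤ b → p (k + 1) - p k ≤ C) {x y : ℝ} (hax : a ≤ x) (hxy : x ≤ y)
    (hyb : y ≤ b) : intInterp p y - intInterp p x ≤ C * (y - x) := by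
  have key := mul_le_intInterp_sub (p := -p) (c := -C) (a := a) (b := b)
    (fun k h1 h2 => by have := h k h1 h2; simp only [Pi.neg_apply]; linarith) hax hxy hyb
  simp only [intInterp, Pi.neg_apply] at key ⊢
  linarith

theorem exists_slope_bounds {p : ℤ → ℝ} (hp : StrictMono p) (s t : ℝ) (hst : s ≤ t) :
    ∃ c C, 0 < c ∧ 0 < C ∧ ∀ x y, s ≤ x → x ≤ y → y ≤ t →
      c * (y - x) ≤ intInterp p y - intInterp p x ∧
      intInterp p y - intInterp p x ≤ C * (y - x) := by
  have hne : (Finset.Icc ⌊s⌋ ⌈t⌉).Nonempty := Finset.nonempty_Icc.2 (by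
    exact_mod_cast (Int.floor_le s).trans (hst.trans (Int.le_ceil t)))
  obtain ⟨m, -, hm⟩ := Finset.exists_min_image _ (fun k => p (k + 1) - p k) hne
  obtain ⟨M, -, hM⟩ := Finset.exists_max_image _ (fun k => p (k + 1) - p k) hne
  refine ⟨_, _, sub_pos.2 (hp (lt_add_one m)), sub_pos.2 (hp (lt_add_one M)),
    fun x y hx hxy hy => ⟨?_, ?_⟩⟩
  · exact mul_le_intInterp_sub (fun k h1 h2 => hm k (Finset.mem_Icc.2 ⟨h1, h2⟩))
      ((Int.floor_le s).trans hx) hxy (hy.trans (Int.le_ceil t))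
  · exact intInterp_sub_le_mul (fun k h1 h2 => hM k (Finset.mem_Icc.2 ⟨h1, h2⟩))
      ((Int.floor_le s).trans hx) hxy (hy.trans (Int.le_ceil t))

theorem intInterp_mem_Icc {p : ℤ → ℝ} (hp : StrictMono p) (x : ℝ) :
    intInterp p x ∈ Set.Icc (p ⌊x⌋) (p (⌊x⌋ + 1)) := by
  have h0 := Int.fract_nonneg x
  have h1 := Int.fract_lt_one x
  have h2 := hp (lt_add_one ⌊x⌋)
  unfold intInterp
  constructor <;> nlinarith

theorem exists_intInterp_eq {p : ℤ → ℝ} (hp : StrictMono p) (hlow : ∀ ε > 0, ∃ k, p k < ε)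
    (hhigh : ∀ M, ∃ k, M < p k) {y : ℝ} (hy : 0 < y) : ∃ x, intInterp p x = y := by
  obtain ⟨l, hl⟩ := hlow y hy
  obtain ⟨u, hu⟩ := hhigh y
  obtain ⟨k, hk, hmax⟩ := Int.exists_greatest_of_bdd (P := fun k => p k ≤ y)
    ⟨u, fun z hz => (hp.lt_iff_lt.1 (lt_of_le_of_lt hz hu)).le⟩ ⟨l, hl.le⟩
  have hk1 : y < p (k + 1) := not_le.1 fun h => by have := hmax _ h; lia
  have hd : 0 < p (k + 1) - p k := by linarith
  have hfl : ⌊(k : ℝ) + (y - p k) / (p (k + 1) - p k)⌋ = k := by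
    rw [Int.floor_eq_iff]
    have h1 : 0 ≤ (y - p k) / (p (k + 1) - p k) := div_nonneg (by linarith) hd.le
    have h2 : (y - p k) / (p (k + 1) - p k) < 1 := (div_lt_one hd).2 (by linarith)
    constructor <;> linarith
  refine ⟨k + (y - p k) / (p (k + 1) - p k), ?_⟩
  rw [intInterp, Int.fract, hfl, add_sub_cancel_left, div_mul_cancel₀ _ hd.ne']
  ring

theorem exists_orderIso_interpolating {p : ℤ → ℝ} (hp : StrictMono p) (hpos : ∀ k, 0 < p k)
    (hlow : ∀ ε > 0, ∃ k, p k < ε) (hhigh : ∀ M, ∃ k, M < p k) :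
    ∃ e : ℝ ≃o ℝ, e 0 = 0 ∧
      (∀ r, 0 < r → e r ∈ Set.Icc (p ⌊Real.log r⌋) (p (⌊Real.log r⌋ + 1))) ∧
      ∀ A B, 0 < A → A ≤ B → ∃ c C, 0 < c ∧ 0 < C ∧ ∀ y z, A ≤ y → y ≤ z → z ≤ B →
        c * (z - y) ≤ e.symm z - e.symm y ∧ e.symm z - e.symm y ≤ C * (z - y) := by
  let f : ℝ → ℝ := fun r => if r ≤ 0 then r else intInterp p (Real.log r)
  have hf0 : ∀ r, r ≤ 0 → f r = r := fun r hr => if_pos hr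
  have hf1 : ∀ r, 0 < r → f r = intInterp p (Real.log r) := fun r hr => if_neg hr.not_ge
  have hfpos : ∀ r, 0 < r → 0 < f r := fun r hr => by
    rw [hf1 r hr]
    exact (hpos _).trans_le (intInterp_mem_Icc hp _).1
  have hmono : StrictMono f := by
    intro s t hst
    rcases le_or_gt t 0 with ht | ht
    · rwa [hf0 s (hst.le.trans ht), hf0 t ht]
    rcases le_or_gt s 0 with hs | hs
    · rw [hf0 s hs]
      exact hs.trans_lt (hfpos t ht)
    · have hlog := Real.log_lt_log hs hst
      obtain ⟨c, C, hc, -, h⟩ := exists_slope_bounds hp _ _ hlog.le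
      have := (h _ _ le_rfl hlog.le le_rfl).1
      rw [hf1 s hs, hf1 t ht]
      linarith [mul_pos hc (sub_pos.2 hlog)]
  have hsurj : Function.Surjective f := by
    intro y
    rcases le_or_gt y 0 with hy | hy
    · exact ⟨y, hf0 y hy⟩
    · obtain ⟨x, hx⟩ := exists_intInterp_eq hp hlow hhigh hy
      exact ⟨Real.exp x, by rw [hf1 _ (Real.exp_pos x), Real.log_exp, hx]⟩
  let e : ℝ ≃o ℝ := hmono.orderIsoOfSurjective f hsurj
  have he : ∀ r, e r = f r := fun _ => rfl
  have he0 : e 0 = 0 := hf0 0 le_rfl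
  refine ⟨e, he0, fun r hr => ?_, fun A B hA hAB => ?_⟩
  · rw [he, hf1 r hr]
    exact intInterp_mem_Icc hp _
  · set a := e.symm A with ha
    set b := e.symm B with hb
    have ha0 : 0 < a := by rw [ha, e.lt_symm_apply, he0]; exact hA
    have hab : a ≤ b := e.symm.monotone hAB
    obtain ⟨c, C, hc, hC, h⟩ := exists_slope_bounds hp _ _ (Real.log_le_log ha0 hab)
    refine ⟨a / C, b / c, div_pos ha0 hC, div_pos (ha0.trans_le hab) hc, fun y z hy hyz hz => ?_⟩
    have hs : a ≤ e.symm y := e.symm.monotone hy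
    have hst : e.symm y ≤ e.symm z := e.symm.monotone hyz
    have ht : e.symm z ≤ b := e.symm.monotone hz
    set s := e.symm y with hs'
    set t := e.symm z with ht'
    have hs0 : 0 < s := ha0.trans_le hs
    have ht0 : 0 < t := hs0.trans_le hst
    have hy' : y = intInterp p (Real.log s) := by rw [← hf1 s hs0, ← he, hs', e.apply_symm_apply]
    have hz' : z = intInterp p (Real.log t) := by rw [← hf1 t ht0, ← he, ht', e.apply_symm_apply]
    obtain ⟨h1, h2⟩ := h (Real.log s) (Real.log t) (Real.log_le_log ha0 hs)
      (Real.log_le_log hs0 hst) (Real.log_le_log ht0 ht)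
    rw [← hy', ← hz'] at h1 h2
    have hlog : Real.log t - Real.log s = Real.log (t / s) := (Real.log_div ht0.ne' hs0.ne').symm
    have hup : Real.log t - Real.log s ≤ (t - s) / a := by
      rw [hlog]
      refine (Real.log_le_sub_one_of_pos (div_pos ht0 hs0)).trans ?_
      rw [div_sub_one hs0.ne']
      exact div_le_div_of_nonneg_left (sub_nonneg.2 hst) ha0 hs
    have hdown : (t - s) / b ≤ Real.log t - Real.log s := by
      rw [hlog]
      refine le_trans ?_ (Real.one_sub_inv_le_log_of_pos (div_pos ht0 hs0))
      rw [inv_div, one_sub_div ht0.ne']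
      exact div_le_div_of_nonneg_left (sub_nonneg.2 hst) ht0 ht
    constructor
    · have h3 : z - y ≤ C * ((t - s) / a) := h2.trans (mul_le_mul_of_nonneg_left hup hC.le)
      rw [div_mul_eq_mul_div, div_le_iff₀ hC]
      rw [← mul_div_assoc, le_div_iff₀ ha0] at h3
      linarith
    · have h3 : c * ((t - s) / b) ≤ z - y := (mul_le_mul_of_nonneg_left hdown hc.le).trans h1
      rw [div_mul_eq_mul_div, le_div_iff₀ hc]
      rw [← mul_div_assoc, div_le_iff₀ (ha0.trans_le hab)] at h3
      linarith

/-- A strictly increasing bi-infinite sequence of positive vectors, tending to `0` and `∞`, along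
which `F` maps each term strictly below its predecessor. -/
theorem exists_decay_sequence {ι : Type*} [Fintype ι] [Nonempty ι] {E : ι → ι → Prop}
    (hE : ∀ i j, Relation.TransGen E i j)
    {F : (ι → ℝ) → ι → ℝ} (hcont : Continuous F) (hmono : Monotone F) (hnonneg : ∀ x, 0 ≤ F x)
    (hgrow : ∀ j i, E j i → ∀ M, ∃ R, ∀ x, R ≤ x j → M ≤ F x i)
    (hlow : ∀ j i, E j i → ∀ a > 0, ∃ c > 0, ∀ x, a ≤ x j → c ≤ F x i)
    (hsg : ∀ x, 0 ≤ x → x ≠ 0 → ∃ i, F x i < x i) :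
    ∃ p : ℤ → ι → ℝ, (∀ i, StrictMono fun k => p k i) ∧ (∀ k i, 0 < p k i) ∧
      (∀ i, ∀ ε > 0, ∃ k, p k i < ε) ∧ (∀ i M, ∃ k, M < p k i) ∧
      ∀ k i, F (p (k + 1)) i < p k i := by
  obtain ⟨δ, hδ, hlip, hgap⟩ := exists_gap_function hE hcont hmono hnonneg hgrow hsg
  obtain ⟨g, hg, hgpos, hglow, hghigh, hgstep⟩ := exists_grid hδ hlip
  have hT : ∀ (n : ι → ℤ) (i : ι), ∃ k, F (fun j => g (n j + 1)) i < g k ∧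
      ∀ l, F (fun j => g (n j + 1)) i < g l → k ≤ l := by
    intro n i
    obtain ⟨j, hj⟩ : ∃ j, E j i := by
      obtain ⟨j, -, hj⟩ := Relation.TransGen.tail'_iff.1 (hE i i)
      exact ⟨j, hj⟩
    obtain ⟨c, hc, hc'⟩ := hlow j i hj _ (hgpos (n j + 1))
    obtain ⟨l, hl⟩ := hglow c hc
    exact Int.exists_least_of_bdd
      ⟨l, fun z hz => (hg.lt_iff_lt.1 (hl.trans_le ((hc' _ le_rfl).trans hz.le))).le⟩
      (hghigh _)
  choose T hTlt hTmin using hT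
  have hTmono : Monotone T := fun n m hnm i => hTmin n i _ <|
    lt_of_le_of_lt (hmono (fun j => hg.monotone (add_le_add_left (hnm j) 1)) i) (hTlt m i)
  have hTsg : ∀ n, ∃ i, T n i < n i := by
    intro n
    obtain ⟨i, hi⟩ := hgap (fun j => g (n j + 1)) (fun j => (hgpos _).le)
      (fun h => (hgpos (n (Classical.arbitrary ι) + 1)).ne' (congrFun h _))
    refine ⟨i, Int.lt_of_le_sub_one (hTmin n i _ (lt_of_le_of_lt hi ?_))⟩
    have := hgstep (n i + 1)
    rwa [show n i + 1 - 2 = n i - 1 by ring] at this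
  obtain ⟨n, hn, hnT, hnhigh, hnlow⟩ := exists_biinfinite_orbit hE hTmono hTsg
    (by
      intro j i hji M
      obtain ⟨R, hR⟩ := hgrow j i hji (g M)
      obtain ⟨k, hk⟩ := hghigh R
      refine ⟨k, fun m hm => (hg.lt_iff_lt.1 (lt_of_le_of_lt (hR _ ?_) (hTlt m i))).le⟩
      exact hk.le.trans (hg.monotone (by lia)))
    (by
      intro j i hji M
      obtain ⟨c, hc, hc'⟩ := hlow j i hji _ (hgpos M)
      obtain ⟨k, hk⟩ := hglow c hc
      refine ⟨k, fun m hm =>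
        (hg.lt_iff_lt.1 (hk.trans_le ((hc' _ ?_).trans (hTlt m i).le))).le⟩
      exact hg.monotone (by lia))
  let p : ℤ → ι → ℝ := fun k i =>
    g (n k i) + Real.sigmoid k * (g (n k i + 1) - g (n k i))
  have hp : ∀ k i, g (n k i) < p k i ∧ p k i < g (n k i + 1) := by
    intro k i
    have h1 := sub_pos.2 (hg (lt_add_one (n k i)))
    have h2 := mul_pos (Real.sigmoid_pos (k : ℝ)) h1
    have h3 := mul_pos (sub_pos.2 (Real.sigmoid_lt_one (k : ℝ))) h1
    simp only [p]
    constructor <;> linarith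
  refine ⟨p, fun i k l hkl => ?_, fun k i => (hgpos _).trans (hp k i).1, fun i ε hε => ?_,
    fun i M => ?_, fun k i => ?_⟩
  · rcases (hn hkl.le i).eq_or_lt with h | h
    · have h1 : Real.sigmoid k < Real.sigmoid l := Real.sigmoid_strictMono (by exact_mod_cast hkl)
      have h2 := mul_pos (sub_pos.2 h1) (sub_pos.2 (hg (lt_add_one (n l i))))
      simp only [p, h]
      linarith
    · exact (hp k i).2.trans ((hg.monotone h).trans_lt (hp l i).1)
  · obtain ⟨m, hm⟩ := hglow ε hε
    obtain ⟨k, hk⟩ := hnlow (m - 1)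
    have := hk i
    exact ⟨k, (hp k i).2.trans ((hg.monotone (by lia)).trans_lt hm)⟩
  · obtain ⟨m, hm⟩ := hghigh M
    obtain ⟨k, hk⟩ := hnhigh m
    exact ⟨k, hm.trans ((hg.monotone (hk i)).trans_lt (hp k i).1)⟩
  · have h1 := hmono (fun j => (hp (k + 1) j).2.le) i
    have h2 := hTlt (n (k + 1)) i
    rw [hnT] at h2
    exact h1.trans_lt (h2.trans (hp k i).1)

theorem exists_orderIso_path {ι : Type*} [Fintype ι] [Nonempty ι] {E : ι → ι → Prop}
    (hE : ∀ i j, Relation.TransGen E i j)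
    {F : (ι → ℝ) → ι → ℝ} (hcont : Continuous F) (hmono : Monotone F) (hnonneg : ∀ x, 0 ≤ F x)
    (hgrow : ∀ j i, E j i → ∀ M, ∃ R, ∀ x, R ≤ x j → M ≤ F x i)
    (hlow : ∀ j i, E j i → ∀ a > 0, ∃ c > 0, ∀ x, a ≤ x j → c ≤ F x i)
    (hsg : ∀ x, 0 ≤ x → x ≠ 0 → ∃ i, F x i < x i) :
    ∃ e : ι → ℝ ≃o ℝ, (∀ i, e i 0 = 0) ∧ (∀ r, 0 < r → ∀ i, F (fun j => e j r) i < e i r) ∧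
      ∀ A B, 0 < A → A ≤ B → ∃ c C, 0 < c ∧ c < C ∧ ∀ i y z, A ≤ y → y ≤ z → z ≤ B →
        c * (z - y) ≤ (e i).symm z - (e i).symm y ∧
        (e i).symm z - (e i).symm y ≤ C * (z - y) := by
  obtain ⟨p, hp, hpos, hplow, hphigh, hpF⟩ := exists_decay_sequence hE hcont hmono hnonneg
    hgrow hlow hsg
  choose e he0 hemem hebd using fun i => exists_orderIso_interpolating (hp i)
    (fun k => hpos k i) (hplow i) (hphigh i)
  refine ⟨e, he0, fun r hr i => ?_, fun A B hA hAB => ?_⟩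
  · exact (hmono (fun j => (hemem j r hr).2) i).trans_lt
      ((hpF _ i).trans_le (hemem i r hr).1)
  · choose c C hc hC hcC using fun i => hebd i A B hA hAB
    obtain ⟨m, hm⟩ := Finite.exists_min c
    obtain ⟨M, hM⟩ := Finite.exists_max C
    refine ⟨c m, C M + c m, hc m, by linarith [hC M], fun i y z hy hyz hz => ?_⟩
    obtain ⟨h1, h2⟩ := hcC i y z hy hyz hz
    have h3 := sub_nonneg.2 hyz
    exact ⟨(mul_le_mul_of_nonneg_right (hm i) h3).trans h1,
      h2.trans (mul_le_mul_of_nonneg_right (by linarith [hM i, hc m]) h3)⟩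

theorem deriv_mem_Icc_of_slope_bounds {f : ℝ → ℝ} {A B c C r : ℝ} (hr : r ∈ Set.Ioo A B)
    (h : ∀ y z, A ≤ y → y ≤ z → z ≤ B → c * (z - y) ≤ f z - f y ∧ f z - f y ≤ C * (z - y))
    (hf : DifferentiableAt ℝ f r) : deriv f r ∈ Set.Icc c C := by
  refine isClosed_Icc.mem_of_tendsto (hasDerivAt_iff_tendsto_slope.1 hf.hasDerivAt) ?_
  filter_upwards [nhdsWithin_le_nhds (Ioo_mem_nhds hr.1 hr.2), self_mem_nhdsWithin] with y hy hyr
  rcases lt_or_gt_of_ne (show y ≠ r from hyr) with hlt | hlt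
  · rw [slope_comm, slope_def_field, Set.mem_Icc, le_div_iff₀ (sub_pos.2 hlt),
      div_le_iff₀ (sub_pos.2 hlt)]
    exact h y r hy.1.le hlt.le hr.2.le
  · rw [slope_def_field, Set.mem_Icc, le_div_iff₀ (sub_pos.2 hlt), div_le_iff₀ (sub_pos.2 hlt)]
    exact h r y hr.1.le hlt.le hy.2.le

theorem lipschitzOnWith_of_slope_bounds {f : ℝ → ℝ} {s : Set ℝ} {c C : ℝ} (hc : 0 < c)
    (hcC : c < C) (h : ∀ y ∈ s, ∀ z ∈ s, y ≤ z →
      c * (z - y) ≤ f z - f y ∧ f z - f y ≤ C * (z - y)) :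
    LipschitzOnWith C.toNNReal f s := by
  have key : ∀ y ∈ s, ∀ z ∈ s, y ≤ z → |f z - f y| ≤ C * |z - y| := by
    intro y hy z hz hyz
    obtain ⟨h1, h2⟩ := h y hy z hz hyz
    rw [abs_of_nonneg (sub_nonneg.2 hyz), abs_of_nonneg]
    · exact h2
    · exact (mul_nonneg hc.le (sub_nonneg.2 hyz)).trans h1
  refine LipschitzOnWith.of_dist_le_mul fun y hy z hz => ?_
  rw [Real.coe_toNNReal _ (hc.trans hcC).le, Real.dist_eq, Real.dist_eq]
  rcases le_total y z with hyz | hyz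
  · rw [abs_sub_comm (f y), abs_sub_comm y]
    exact key y hy z hz hyz
  · exact key z hz y hy hyz

theorem MAF.monotone {m : ℕ} {μ : (Fin m → ℝ) → ℝ} (hμ : MAF μ) : Monotone μ := by
  intro x y hxy
  have hlim : Tendsto (fun ε : ℝ => μ fun k => y k + ε) (𝓝[>] 0) (𝓝 (μ y)) := by
    have hc : Continuous fun ε : ℝ => μ fun k => y k + ε := hμ.1.comp (by fun_prop)
    simpa using (hc.tendsto 0).mono_left nhdsWithin_le_nhds
  refine ge_of_tendsto hlim ?_
  filter_upwards [self_mem_nhdsWithin] with ε hε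
  exact (hμ.2.2.2.1 _ _ fun k => lt_add_of_le_of_pos (hxy k) hε).le

/-- The gain operator, extended to all of `ℝ^N` by truncating negative entries to `0`. -/
noncomputable def gainOperator {N : ℕ} (γ : Fin N → Fin N → ℝ → ℝ)
    (μ : Fin N → (Fin N → ℝ) → ℝ) (x : Fin N → ℝ) (i : Fin N) : ℝ :=
  μ i fun j => γ i j (max (x j) 0)

section GainOperator

variable {N : ℕ} {γ : Fin N → Fin N → ℝ → ℝ} {μ : Fin N → (Fin N → ℝ) → ℝ}

theorem gainOperator_of_nonneg {x : Fin N → ℝ} (hx : ∀ i, 0 ≤ x i) (i : Fin N) :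
    gainOperator γ μ x i = μ i fun j => γ i j (x j) := by
  simp only [gainOperator, max_eq_left (hx _)]

theorem gain_nonneg (hγ : ∀ i j, ClassKInf (γ i j) ∨ γ i j = 0) (i j : Fin N) {r : ℝ}
    (hr : 0 ≤ r) : 0 ≤ γ i j r := by
  rcases hγ i j with h | h
  · exact h.1.2.2.1 r hr
  · simp [h]

theorem gain_mono (hγ : ∀ i j, ClassKInf (γ i j) ∨ γ i j = 0) (i j : Fin N) {r s : ℝ}
    (hr : 0 ≤ r) (hrs : r ≤ s) : γ i j r ≤ γ i j s := by
  rcases hγ i j with h | h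
  · exact h.1.2.1.monotoneOn hr (hr.trans hrs) hrs
  · simp [h]

theorem continuous_gainOperator (hγ : ∀ i j, ClassKInf (γ i j) ∨ γ i j = 0)
    (hμ : ∀ i, MAF (μ i)) : Continuous (gainOperator γ μ) := by
  refine continuous_pi fun i => (hμ i).1.comp (continuous_pi fun j => ?_)
  rcases hγ i j with h | h
  · exact h.1.1.comp_continuous (by fun_prop) fun x => Set.mem_Ici.2 (le_max_right _ _)
  · simp only [h]
    exact continuous_const

theorem monotone_gainOperator (hγ : ∀ i j, ClassKInf (γ i j) ∨ γ i j = 0)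
    (hμ : ∀ i, MAF (μ i)) : Monotone (gainOperator γ μ) := fun _ _ hxy i =>
  (hμ i).monotone fun j => gain_mono hγ i j (le_max_right _ _) (max_le_max_right 0 (hxy j))

theorem gainOperator_nonneg (hγ : ∀ i j, ClassKInf (γ i j) ∨ γ i j = 0)
    (hμ : ∀ i, MAF (μ i)) (x : Fin N → ℝ) : 0 ≤ gainOperator γ μ x := fun i =>
  (hμ i).2.1 _ fun j => gain_nonneg hγ i j (le_max_right _ _)

theorem single_le_gainOperator (hγ : ∀ i j, ClassKInf (γ i j) ∨ γ i j = 0)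
    (hμ : ∀ i, MAF (μ i)) {x : Fin N → ℝ} (i j : Fin N) {a : ℝ} (ha : 0 ≤ a) (hax : a ≤ x j) :
    μ i (Pi.single j (γ i j a)) ≤ gainOperator γ μ x i := by
  refine (hμ i).monotone fun k => ?_
  rcases eq_or_ne k j with rfl | hk
  · rw [Pi.single_eq_same]
    exact gain_mono hγ i k ha (hax.trans (le_max_left _ _))
  · rw [Pi.single_eq_of_ne hk]
    exact gain_nonneg hγ i k (le_max_right _ _)

theorem gainOperator_unbounded (hγ : ∀ i j, ClassKInf (γ i j) ∨ γ i j = 0)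
    (hμ : ∀ i, MAF (μ i)) {i j : Fin N} (hij : γ i j ≠ 0) (M : ℝ) :
    ∃ R, ∀ x : Fin N → ℝ, R ≤ x j → M ≤ gainOperator γ μ x i := by
  obtain ⟨R, hR⟩ := (hμ i).2.2.2.2 M
  obtain ⟨a, haR, ha⟩ := ((((hγ i j).resolve_right hij).2.eventually_ge_atTop R).and
    (eventually_ge_atTop 0)).exists
  refine ⟨a, fun x hx => (hR _ (fun k => ?_) ?_).trans (single_le_gainOperator hγ hμ i j ha hx)⟩
  · exact (Pi.single_nonneg.2 (gain_nonneg hγ i j ha) : (0 : Fin N → ℝ) ≤ _) k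
  · rw [Pi.norm_single]
    exact haR.trans (le_abs_self _)

theorem gainOperator_bounded_away (hγ : ∀ i j, ClassKInf (γ i j) ∨ γ i j = 0)
    (hμ : ∀ i, MAF (μ i)) {i j : Fin N} (hij : γ i j ≠ 0) {a : ℝ} (ha : 0 < a) :
    ∃ c > 0, ∀ x : Fin N → ℝ, a ≤ x j → c ≤ gainOperator γ μ x i := by
  refine ⟨_, (hμ i).2.2.1 (Pi.single j (γ i j a)) (fun k => ?_) ?_,
    fun x hx => single_le_gainOperator hγ hμ i j ha.le hx⟩
  · exact (Pi.single_nonneg.2 (gain_nonneg hγ i j ha.le) : (0 : Fin N → ℝ) ≤ _) k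
  · have h := ((hγ i j).resolve_right hij).1
    have := h.2.1 Set.self_mem_Ici ha.le ha
    rw [h.2.2.2] at this
    rw [Ne, Pi.single_eq_zero_iff]
    exact this.ne'

end GainOperator

theorem exists_orderIso_path_gain {N : ℕ} (hN : 0 < N) {γ : Fin N → Fin N → ℝ → ℝ}
    {μ : Fin N → (Fin N → ℝ) → ℝ} (hγ : ∀ i j, ClassKInf (γ i j) ∨ γ i j = 0)
    (hμ : ∀ i, MAF (μ i))
    (hirr : ∀ i j : Fin N, Relation.ReflTransGen (fun a b : Fin N => γ b a ≠ 0) i j)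
    (hsg : ∀ r : Fin N → ℝ, (∀ i, 0 ≤ r i) → r ≠ 0 →
      ∃ i, μ i (fun j => γ i j (r j)) < r i) :
    ∃ e : Fin N → ℝ ≃o ℝ, (∀ i, e i 0 = 0) ∧
      (∀ r, 0 < r → ∀ i, μ i (fun j => γ i j (e j r)) < e i r) ∧
      ∀ A B, 0 < A → A ≤ B → ∃ c C, 0 < c ∧ c < C ∧ ∀ i y z, A ≤ y → y ≤ z → z ≤ B →
        c * (z - y) ≤ (e i).symm z - (e i).symm y ∧
        (e i).symm z - (e i).symm y ≤ C * (z - y) := by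
  have : NeZero N := ⟨hN.ne'⟩
  by_cases hrow : ∀ i, ∃ j, γ i j ≠ 0
  · have hE : ∀ i j, Relation.TransGen (fun a b : Fin N => γ b a ≠ 0) i j := fun i j => by
      obtain ⟨k, hk⟩ := hrow j
      exact Relation.TransGen.tail' (hirr i k) hk
    obtain ⟨e, he0, heF, hebd⟩ := exists_orderIso_path hE (continuous_gainOperator hγ hμ)
      (monotone_gainOperator hγ hμ) (gainOperator_nonneg hγ hμ)
      (fun j i h => gainOperator_unbounded hγ hμ h)
      (fun j i h a ha => gainOperator_bounded_away hγ hμ h ha)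
      (fun x hx hx0 => by
        obtain ⟨i, hi⟩ := hsg x hx hx0
        exact ⟨i, by rwa [gainOperator_of_nonneg hx]⟩)
    refine ⟨e, he0, fun r hr i => ?_, hebd⟩
    have h := heF r hr i
    rwa [gainOperator_of_nonneg fun j => by rw [← he0 j]; exact (e j).monotone hr.le] at h
  · -- a zero row forces `N = 1`, and any contraction can replace the gain operator
    push Not at hrow
    obtain ⟨i₀, hi₀⟩ := hrow
    have huniq : ∀ i, i = i₀ := fun i => by
      rcases Relation.ReflTransGen.cases_tail_iff _ _ _ |>.1 (hirr i i₀) with h | ⟨k, -, hk⟩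
      · exact h.symm
      · exact absurd (hi₀ k) hk
    obtain ⟨e, he0, -, hebd⟩ := exists_orderIso_path (ι := Fin N) (E := fun _ _ => True)
      (F := fun x i => max (x i) 0 / 2) (fun i j => Relation.TransGen.single trivial)
      (by fun_prop) (fun x y hxy i => by
        have := max_le_max_right 0 (hxy i)
        simp only
        linarith)
      (fun x i => div_nonneg (le_max_right _ _) zero_le_two)
      (fun j i _ M => ⟨2 * M, fun x hx => by
        rw [huniq j, ← huniq i] at hx
        linarith [le_max_left (x i) 0]⟩)
      (fun j i _ a ha => ⟨a / 2, half_pos ha, fun x hx => by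
        rw [huniq j, ← huniq i] at hx
        linarith [le_max_left (x i) 0]⟩)
      (fun x hx hx0 => by
        obtain ⟨i, hi⟩ := Function.ne_iff.1 hx0
        have hpos : 0 < x i := lt_of_le_of_ne (hx i) (Ne.symm hi)
        exact ⟨i, by rw [max_eq_left hpos.le]; linarith⟩)
    have hepos : ∀ r, 0 < r → ∀ i, 0 < e i r := fun r hr i => by
      rw [← he0 i]
      exact (e i).strictMono hr
    refine ⟨e, he0, fun r hr i => ?_, hebd⟩
    obtain ⟨k, hk⟩ := hsg (fun j => e j r) (fun j => (hepos r hr j).le)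
      (fun h => (hepos r hr i).ne' (congrFun h i))
    rwa [huniq k, ← huniq i] at hk

/-- **Existence of an Ω-path (Theorem 3 of the paper, after
Dashkovskiy–Rüffer–Wirth).** Let `Γ = (γ_{ij})` be a matrix of functions of class K∞
or identically zero aggregated by MAFs `μ_i` into `Γ_μ(r)_i = μ_i(γ_{i1}(r_1),…,γ_{iN}(r_N))`.
If `Γ` is irreducible (the graph with an edge from `j` to `i` whenever `γ_{ij} ≢ 0` is
strongly connected) and `Γ_μ ≱ id`, then there is an Ω-path `σ` with respect to
`Γ_μ`: class-K∞ functions `σ_i` with locally Lipschitz inverses on `(0,∞)`, whose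
inverses have derivatives (where they exist) bounded away from `0` and `∞` on compact
subsets of `(0,∞)`, such that `Γ_μ(σ(r)) < σ(r)` componentwise for all `r > 0`. -/
theorem statement4 (N : ℕ) (hN : 0 < N)
    (γ : Fin N → Fin N → ℝ → ℝ)
    (μ : Fin N → (Fin N → ℝ) → ℝ)
    (hγ : ∀ i j, ClassKInf (γ i j) ∨ γ i j = 0)
    (hμ : ∀ i, MAF (μ i))
    -- irreducibility: strong connectivity of the graph with an edge `j → i` iff `γ i j ≢ 0`
    (hirr : ∀ i j : Fin N, Relation.ReflTransGen (fun a b : Fin N => γ b a ≠ 0) i j)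
    -- `Γ_μ ≱ id`
    (hsg : ∀ r : Fin N → ℝ, (∀ i, 0 ≤ r i) → r ≠ 0 →
      ∃ i, μ i (fun j => γ i j (r j)) < r i) :
    ∃ σ σinv : Fin N → ℝ → ℝ,
      (∀ i, ClassKInf (σ i)) ∧
      (∀ i r, 0 ≤ r → σinv i (σ i r) = r ∧ σ i (σinv i r) = r) ∧
      -- (i) each `σ_i⁻¹` is locally Lipschitz continuous on `(0,∞)`
      (∀ i, ∀ y ∈ Set.Ioi (0 : ℝ), ∃ ε > (0 : ℝ), ∃ K : NNReal,
        LipschitzOnWith K (σinv i) (Set.Ioi 0 ∩ Metric.ball y ε)) ∧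
      -- (ii) derivative bounds on compact subsets of `(0,∞)`
      (∀ K : Set ℝ, IsCompact K → K ⊆ Set.Ioi 0 → ∃ c C : ℝ, 0 < c ∧ c < C ∧
        ∀ i, ∀ r ∈ K, DifferentiableAt ℝ (σinv i) r →
          c ≤ deriv (σinv i) r ∧ deriv (σinv i) r ≤ C) ∧
      -- (iii) `Γ_μ(σ(r)) < σ(r)` for all `r > 0`
      (∀ r > (0 : ℝ), ∀ i, μ i (fun j => γ i j (σ j r)) < σ i r) := by
  obtain ⟨e, he0, heF, hebd⟩ := exists_orderIso_path_gain hN hγ hμ hirr hsg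
  refine ⟨fun i => e i, fun i => (e i).symm, fun i => ⟨⟨(e i).continuous.continuousOn,
    (e i).strictMono.strictMonoOn _, fun r hr => ?_, he0 i⟩, (e i).tendsto_atTop⟩,
    fun i r _ => ⟨(e i).symm_apply_apply r, (e i).apply_symm_apply r⟩, fun i y hy => ?_,
    fun K hK hK0 => ?_, heF⟩
  · rw [← he0 i]
    exact (e i).monotone hr
  · have hy0 : 0 < y := hy
    obtain ⟨c, C, hc, hcC, h⟩ := hebd (y / 2) (2 * y) (half_pos hy0) (by linarith)
    refine ⟨y / 2, half_pos hy0, C.toNNReal, lipschitzOnWith_of_slope_bounds hc hcC ?_⟩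
    rintro s ⟨-, hs⟩ t ⟨-, ht⟩ hst
    rw [Real.ball_eq_Ioo] at hs ht
    exact h i s t (by linarith [hs.1]) hst (by linarith [ht.2])
  · rcases K.eq_empty_or_nonempty with rfl | hne
    · exact ⟨1, 2, one_pos, one_lt_two, by simp⟩
    obtain ⟨a, ha, hmin⟩ := hK.exists_isLeast hne
    obtain ⟨b, hb, hmax⟩ := hK.exists_isGreatest hne
    have ha0 : 0 < a := hK0 ha
    have hab : a ≤ b := hmin hb
    obtain ⟨c, C, hc, hcC, h⟩ := hebd (a / 2) (2 * b) (half_pos ha0) (by linarith)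
    refine ⟨c, C, hc, hcC, fun i r hr hdiff => ?_⟩
    have har := hmin hr
    have hrb := hmax hr
    exact deriv_mem_Icc_of_slope_bounds ⟨by linarith, by linarith⟩ (h i) hdiff
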